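/- Equality of the tubular-neighbourhood descriptions E₁ and E₃ of the almost Cayley planes: fix ε₁ ∈ (0,1) and set ε₃ = (1−ε₁)⁻² − 1. Then for every orthonormal quadruple (f₁,f₂,f₃,f₄) of vectors in ℝ⁸ the following are equivalent: (a) Φ₀(f₁,f₂,f₃,f₄) > 1 − ε₁; (b) there exist a real number α with 0 ≤ α < ε₃ and a unit vector v ∈ ℝ⁸ orthogonal to f₁, f₂, f₃ and to f₁×f₂×f₃, such that f₄ = (1+α)^{−1/2}·(f₁×f₂×f₃ + √α·v). Moreover in case (b) one has Φ₀(f₁,f₂,f₃,f₄) = (1+α)^{−1/2}. -/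

import Mathlib

open scoped BigOperators RealInnerProductSpace

noncomputable section

/-- ℝ⁸ with its Euclidean inner product. -/
abbrev V8 : Type := EuclideanSpace ℝ (Fin 8)

/-- The standard orthonormal basis vectors e₁, …, e₈ of ℝ⁸ (indexed by `Fin 8`). -/
def e (i : Fin 8) : V8 := EuclideanSpace.single i (1 : ℝ)

/-- The alternating 4-form `dxᵢ ∧ dxⱼ ∧ dx_k ∧ dx_l` on ℝ⁸. -/
def dxQ (i j k l : Fin 8) : AlternatingMap ℝ V8 ℝ (Fin 4) :=
  (Matrix.detRowAlternating : AlternatingMap ℝ (Fin 4 → ℝ) ℝ (Fin 4)).compLinearMap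
    (LinearMap.pi fun a : Fin 4 =>
      ((EuclideanSpace.proj (![i, j, k, l] a) : V8 →L[ℝ] ℝ) : V8 →ₗ[ℝ] ℝ))

/-- The standard Cayley form Φ₀ on ℝ⁸. -/
def Phi0 : AlternatingMap ℝ V8 ℝ (Fin 4) :=
  dxQ 0 1 2 3 - dxQ 0 1 4 5 - dxQ 0 1 6 7 - dxQ 0 2 4 6 + dxQ 0 2 5 7 -
    dxQ 0 3 4 7 - dxQ 0 3 5 6 - dxQ 1 2 4 7 - dxQ 1 2 5 6 + dxQ 1 3 4 6 -
    dxQ 1 3 5 7 - dxQ 2 3 4 5 - dxQ 2 3 6 7 + dxQ 4 5 6 7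

/-- The triple product `u×v×w = (ι(u)ι(v)ι(w)Φ₀)^♯`, i.e. the unique vector with
`⟨u×v×w, x⟩ = Φ₀(u,v,w,x)` for all `x`. -/
def tripleProd (u v w : V8) : V8 :=
  ∑ i : Fin 8, Phi0 ![u, v, w, e i] • e i

/-- The `3 × 3` minor of the matrix with rows `u, v, w` in the columns `i, j, k`. -/
def minor (u v w : V8) (i j k : Fin 8) : ℝ :=
  u i * (v j * w k - v k * w j) - u j * (v i * w k - v k * w i) + u k * (v i * w j - v j * w i)

theorem dxQ_apply (i j k l : Fin 8) (u v w x : V8) :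
    dxQ i j k l ![u, v, w, x] = x l * minor u v w i j k - x k * minor u v w i j l +
      x j * minor u v w i k l - x i * minor u v w j k l := by
  have h : dxQ i j k l ![u, v, w, x] = Matrix.det !![u i, u j, u k, u l; v i, v j, v k, v l;
      w i, w j, w k, w l; x i, x j, x k, x l] := by
    refine congrArg (Matrix.det (n := Fin 4) (R := ℝ)) ?_
    ext a b
    fin_cases a <;> fin_cases b <;> rfl
  rw [h, Matrix.det_succ_row _ 3]
  simp only [Fin.sum_univ_four, Matrix.det_fin_three, Matrix.submatrix_apply]
  simp [Fin.succAbove, minor]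
  ring

theorem inner_tripleProd (u v w x : V8) : ⟪tripleProd u v w, x⟫ = Phi0 ![u, v, w, x] := by
  have hx : x = ∑ i, x i • e i := by
    ext j; simp [e, Pi.single_apply]
  have h : Phi0 ![u, v, w, x] = ∑ i, x i * Phi0 ![u, v, w, e i] := by
    have hu : ∀ y : V8, Phi0 ![u, v, w, y] =
        Phi0.toMultilinearMap.toLinearMap ![u, v, w, 0] 3 y := by
      intro y
      simp only [MultilinearMap.toLinearMap_apply, AlternatingMap.coe_multilinearMap]
      congr 1
      ext i; fin_cases i <;> simp [Function.update]
    simp only [hu]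
    conv_lhs => rw [hx]
    simp
  rw [h, tripleProd, sum_inner]
  refine Finset.sum_congr rfl fun i _ => ?_
  simp [inner_smul_left, e, EuclideanSpace.inner_single_left, mul_comm]

theorem tripleProd_apply (u v w : V8) (i : Fin 8) :
    tripleProd u v w i = Phi0 ![u, v, w, e i] := by
  rw [← inner_tripleProd, e, EuclideanSpace.inner_single_right]
  simp

theorem tripleProd_eq_minors (u v w : V8) : tripleProd u v w = !₂[
    -minor u v w 1 2 3 + minor u v w 1 4 5 + minor u v w 1 6 7 + minor u v w 2 4 6 -
      minor u v w 2 5 7 + minor u v w 3 4 7 + minor u v w 3 5 6,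
    minor u v w 0 2 3 - minor u v w 0 4 5 - minor u v w 0 6 7 + minor u v w 2 4 7 +
      minor u v w 2 5 6 - minor u v w 3 4 6 + minor u v w 3 5 7,
    -minor u v w 0 1 3 - minor u v w 0 4 6 + minor u v w 0 5 7 - minor u v w 1 4 7 -
      minor u v w 1 5 6 + minor u v w 3 4 5 + minor u v w 3 6 7,
    minor u v w 0 1 2 - minor u v w 0 4 7 - minor u v w 0 5 6 + minor u v w 1 4 6 -
      minor u v w 1 5 7 - minor u v w 2 4 5 - minor u v w 2 6 7,
    minor u v w 0 1 5 + minor u v w 0 2 6 + minor u v w 0 3 7 + minor u v w 1 2 7 -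
      minor u v w 1 3 6 + minor u v w 2 3 5 - minor u v w 5 6 7,
    -minor u v w 0 1 4 - minor u v w 0 2 7 + minor u v w 0 3 6 + minor u v w 1 2 6 +
      minor u v w 1 3 7 - minor u v w 2 3 4 + minor u v w 4 6 7,
    minor u v w 0 1 7 - minor u v w 0 2 4 - minor u v w 0 3 5 - minor u v w 1 2 5 +
      minor u v w 1 3 4 + minor u v w 2 3 7 - minor u v w 4 5 7,
    -minor u v w 0 1 6 + minor u v w 0 2 5 - minor u v w 0 3 4 - minor u v w 1 2 4 -
      minor u v w 1 3 5 - minor u v w 2 3 6 + minor u v w 4 5 6] := by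
  ext i
  rw [tripleProd_apply]
  simp only [Phi0, AlternatingMap.add_apply, AlternatingMap.sub_apply, dxQ_apply, e]
  fin_cases i <;> simp <;> ring

set_option maxHeartbeats 4000000 in
theorem inner_tripleProd_self (u v w : V8) :
    ⟪tripleProd u v w, tripleProd u v w⟫ =
      ⟪u, u⟫ * ⟪v, v⟫ * ⟪w, w⟫ + 2 * ⟪u, v⟫ * ⟪v, w⟫ * ⟪u, w⟫
        - ⟪u, u⟫ * ⟪v, w⟫ ^ 2 - ⟪v, v⟫ * ⟪u, w⟫ ^ 2 - ⟪w, w⟫ * ⟪u, v⟫ ^ 2 := by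
  rw [tripleProd_eq_minors]
  simp only [PiLp.inner_apply, Fin.sum_univ_eight, RCLike.inner_apply, conj_trivial,
    Matrix.cons_val, minor]
  ring

theorem inner_tripleProd_eq_zero (f : Fin 4 → V8) {x : V8}
    (hx : x = f 0 ∨ x = f 1 ∨ x = f 2) : ⟪tripleProd (f 0) (f 1) (f 2), x⟫ = 0 := by
  rw [inner_tripleProd]
  rcases hx with rfl | rfl | rfl
  · exact Phi0.map_eq_zero_of_eq _ (i := 0) (j := 3) (by simp) (by decide)
  · exact Phi0.map_eq_zero_of_eq _ (i := 1) (j := 3) (by simp) (by decide)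
  · exact Phi0.map_eq_zero_of_eq _ (i := 2) (j := 3) (by simp) (by decide)

theorem norm_tripleProd {u v w : V8} (hu : ‖u‖ = 1) (hv : ‖v‖ = 1) (hw : ‖w‖ = 1)
    (huv : ⟪u, v⟫ = 0) (huw : ⟪u, w⟫ = 0) (hvw : ⟪v, w⟫ = 0) : ‖tripleProd u v w‖ = 1 := by
  have h := inner_tripleProd_self u v w
  simp only [huv, huw, hvw, real_inner_self_eq_norm_sq, hu, hv, hw] at h
  nlinarith [norm_nonneg (tripleProd u v w)]

theorem exists_unit_vector_orthogonal (a b c d : V8) :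
    ∃ v : V8, ‖v‖ = 1 ∧ ⟪v, a⟫ = 0 ∧ ⟪v, b⟫ = 0 ∧ ⟪v, c⟫ = 0 ∧ ⟪v, d⟫ = 0 := by
  let K : Submodule ℝ V8 := Submodule.span ℝ (Set.range ![a, b, c, d])
  have hK : Module.finrank ℝ K ≤ 4 := by
    exact finrank_range_le_card ![a, b, c, d]
  have hsum := K.finrank_add_finrank_orthogonal
  rw [finrank_euclideanSpace_fin] at hsum
  have : Nontrivial Kᗮ := Module.nontrivial_of_finrank_pos (R := ℝ) (by omega)
  obtain ⟨v, hv⟩ := exists_norm_eq Kᗮ (zero_le_one (α := ℝ))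
  have h : ∀ i, ⟪(v : V8), ![a, b, c, d] i⟫ = 0 := fun i =>
    
    Submodule.inner_left_of_mem_orthogonal (K := K)
      (Submodule.subset_span (Set.mem_range_self i)) v.2
  exact ⟨v, hv, h 0, h 1, h 2, h 3⟩

theorem inner_eq_of_eq_smul_add {T v x : V8} {α : ℝ} (hT : ‖T‖ = 1) (hvT : ⟪v, T⟫ = 0)
    (hx : x = (Real.sqrt (1 + α))⁻¹ • (T + Real.sqrt α • v)) :
    ⟪T, x⟫ = (Real.sqrt (1 + α))⁻¹ := by
  rw [hx, inner_smul_right, inner_add_right, inner_smul_right, real_inner_comm v T, hvT,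
    real_inner_self_eq_norm_sq, hT]
  simp

/-- **Equality of the tubular-neighbourhood descriptions `E₁` and `E₃` of the almost Cayley
planes:** fix `ε₁ ∈ (0,1)` and set `ε₃ = (1−ε₁)⁻² − 1`. For an orthonormal quadruple
`(f₁,f₂,f₃,f₄)` in ℝ⁸: `Φ₀(f₁,f₂,f₃,f₄) > 1 − ε₁` iff there exist `0 ≤ α < ε₃` and a unit
vector `v` orthogonal to `f₁, f₂, f₃` and to `f₁×f₂×f₃` with
`f₄ = (1+α)^{−1/2}(f₁×f₂×f₃ + √α·v)`; moreover, in the latter case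
`Φ₀(f₁,f₂,f₃,f₄) = (1+α)^{−1/2}`. -/
theorem almost_cayley_descriptions (ε₁ : ℝ) (hε₁ : 0 < ε₁) (hε₁' : ε₁ < 1)
    (f : Fin 4 → V8) (hf : Orthonormal ℝ f) :
    (Phi0 f > 1 - ε₁ ↔
      ∃ (α : ℝ) (v : V8), 0 ≤ α ∧ α < ((1 - ε₁) ^ 2)⁻¹ - 1 ∧ ‖v‖ = 1 ∧
        ⟪v, f 0⟫ = 0 ∧ ⟪v, f 1⟫ = 0 ∧ ⟪v, f 2⟫ = 0 ∧
        ⟪v, tripleProd (f 0) (f 1) (f 2)⟫ = 0 ∧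
        f 3 = (Real.sqrt (1 + α))⁻¹ •
          (tripleProd (f 0) (f 1) (f 2) + Real.sqrt α • v)) ∧
    (∀ (α : ℝ) (v : V8), 0 ≤ α → ‖v‖ = 1 →
        ⟪v, f 0⟫ = 0 → ⟪v, f 1⟫ = 0 → ⟪v, f 2⟫ = 0 →
        ⟪v, tripleProd (f 0) (f 1) (f 2)⟫ = 0 →
        f 3 = (Real.sqrt (1 + α))⁻¹ •
          (tripleProd (f 0) (f 1) (f 2) + Real.sqrt α • v) →
        Phi0 f = (Real.sqrt (1 + α))⁻¹) := by
  set T := tripleProd (f 0) (f 1) (f 2) with hT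
  have hPhi : Phi0 f = ⟪T, f 3⟫ := by
    rw [hT, inner_tripleProd]
    congr 1
    ext i; fin_cases i <;> rfl
  have hT1 : ‖T‖ = 1 := norm_tripleProd (hf.1 0) (hf.1 1) (hf.1 2) (hf.2 (by decide))
    (hf.2 (by decide)) (hf.2 (by decide))
  have hf3 : ‖f 3‖ = 1 := hf.1 3
  have hδ : 0 < 1 - ε₁ := by linarith
  refine ⟨⟨fun h => ?_, ?_⟩, fun α v _ _ _ _ _ hvT hx => hPhi.trans
    (inner_eq_of_eq_smul_add hT1 hvT hx)⟩
  · rw [hPhi] at h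
    set c := ⟪T, f 3⟫ with hc
    have hc0 : 0 < c := hδ.trans h
    have hc1 : c ≤ 1 := by simpa [hT1, hf3] using real_inner_le_norm T (f 3)
    have hsqrt : (Real.sqrt (1 + ((c ^ 2)⁻¹ - 1)))⁻¹ = c := by
      rw [add_sub_cancel, Real.sqrt_inv, inv_inv, Real.sqrt_sq hc0.le]
    have hα : (c ^ 2)⁻¹ - 1 < ((1 - ε₁) ^ 2)⁻¹ - 1 := by gcongr
    rcases hc1.eq_or_lt with hc1 | hc1
    · obtain ⟨v, hv, h0, h1, h2, h3⟩ := exists_unit_vector_orthogonal (f 0) (f 1) (f 2) T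
      refine ⟨(c ^ 2)⁻¹ - 1, v, by simp [hc1], hα, hv, h0, h1, h2, h3, ?_⟩
      rw [hsqrt]
      simpa [hc1] using ((inner_eq_one_iff_of_norm_eq_one hT1 hf3).1 hc1).symm
    · have hαpos : 0 < (c ^ 2)⁻¹ - 1 := by
        rw [sub_pos, one_lt_inv₀ (by positivity)]
        nlinarith
      set α := (c ^ 2)⁻¹ - 1 with hαdef
      have hs : 0 < Real.sqrt α := Real.sqrt_pos.2 hαpos
      have horth : ∀ i : Fin 4, i ≠ 3 → ⟪T, f i⟫ = 0 →
          ⟪(Real.sqrt α)⁻¹ • (c⁻¹ • f 3 - T), f i⟫ = 0 := by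
        intro i hi hTi
        rw [inner_smul_left, inner_sub_left, inner_smul_left, hf.2 hi.symm, hTi]
        simp
      refine ⟨α, (Real.sqrt α)⁻¹ • (c⁻¹ • f 3 - T), hαpos.le, hα, ?_,
        horth 0 (by decide) (inner_tripleProd_eq_zero f (by simp)),
        horth 1 (by decide) (inner_tripleProd_eq_zero f (by simp)),
        horth 2 (by decide) (inner_tripleProd_eq_zero f (by simp)), ?_, ?_⟩
      · have hn : ‖c⁻¹ • f 3 - T‖ ^ 2 = α := by
          rw [norm_sub_sq_real, norm_smul, inner_smul_left, real_inner_comm, ← hc, hT1, hf3, hαdef]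
          simp only [Real.norm_eq_abs, mul_one, sq_abs, conj_trivial]
          field_simp
          ring
        rw [norm_smul, norm_inv, Real.norm_of_nonneg hs.le, ← hn, Real.sqrt_sq (norm_nonneg _),
          inv_mul_cancel₀]
        intro h0
        rw [h0] at hn
        simp [← hn] at hαpos
      · rw [inner_smul_left, inner_sub_left, inner_smul_left, real_inner_comm, ← hc,
          real_inner_self_eq_norm_sq, hT1]
        simp [hc0.ne']
      · rw [hsqrt, smul_inv_smul₀ hs.ne', add_sub_cancel, smul_inv_smul₀ hc0.ne']
  · rintro ⟨α, v, hα0, hα, -, -, -, -, hvT, hx⟩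
    rw [hPhi, inner_eq_of_eq_smul_add hT1 hvT hx, gt_iff_lt, lt_inv_comm₀ hδ (by positivity),
      Real.sqrt_lt' (by positivity), inv_pow]
    linarith
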